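/- Let w be an A₂ weight on ℝ^d. Then for every dyadic cube I ∈ 𝒟 and every α ∈ Γ_d, ∑_{J⊆I} ∑_{β: E_{β,J} ⊆ E_{α,I}} |ŵ^{-1/2}(J,β)|² ⟨w⟩_J ≤ C_d · [w]²_{A₂} · |E_{α,I}|, where the sum is over dyadic cubes J ⊆ I and indices β ∈ Γ_d with E_{β,J} ⊆ E_{α,I}, ŵ^{-1/2}(J,β) = ⟨w^{-1/2}, h_J^β⟩_{L²}, and C_d depends only on the dimension d. -/

import Mathlib

open MeasureTheory

noncomputable section

/-- A dyadic cube in `ℝ^d`: the cube `∏ᵢ [mᵢ 2^k, (mᵢ+1) 2^k)`. -/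
structure DyadicCube (d : ℕ) where
  k : ℤ
  m : Fin d → ℤ
deriving DecidableEq

namespace DyadicCube

/-- The underlying set of a dyadic cube. -/
def toSet {d : ℕ} (I : DyadicCube d) : Set (Fin d → ℝ) :=
  {x | ∀ i, (I.m i : ℝ) * (2 : ℝ) ^ I.k ≤ x i ∧ x i < ((I.m i : ℝ) + 1) * (2 : ℝ) ^ I.k}

/-- `J` is a dyadic child of `I`. -/
def IsChild {d : ℕ} (J I : DyadicCube d) : Prop :=
  J.k + 1 = I.k ∧ J.toSet ⊆ I.toSet

end DyadicCube

/-- The index set `Γ_d = {0,1}^d \ {(1,…,1)}`. -/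
def Gamma (d : ℕ) : Type := {v : Fin d → Bool // v ≠ fun _ => true}

instance {d : ℕ} : DecidableEq (Gamma d) := Subtype.instDecidableEq

/-- The average `⟨f⟩_E` of `f` over a set `E`. -/
def avg {d : ℕ} (E : Set (Fin d → ℝ)) (f : (Fin d → ℝ) → ℝ) : ℝ :=
  (∫ x in E, f x) / (volume E).toReal

/-- An axis-parallel cube with corner `c` and side length `r`. -/
def Cube {d : ℕ} (c : Fin d → ℝ) (r : ℝ) : Set (Fin d → ℝ) :=
  {x | ∀ i, c i ≤ x i ∧ x i < c i + r}

/-- `A` is an upper bound for the `A₂` characteristic of `w`: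
`⟨w⟩_I ⟨w⁻¹⟩_I ≤ A` for every cube `I`. -/
def IsA2Bound {d : ℕ} (w : (Fin d → ℝ) → ℝ) (A : ℝ) : Prop :=
  ∀ (c : Fin d → ℝ) (r : ℝ), 0 < r →
    avg (Cube c r) w * avg (Cube c r) (fun x => (w x)⁻¹) ≤ A

/-- A weight: a positive, measurable, locally integrable function (with locally
integrable reciprocal). -/
def IsWeight {d : ℕ} (w : (Fin d → ℝ) → ℝ) : Prop :=
  (∀ x, 0 < w x) ∧ Measurable w ∧ LocallyIntegrable w volume ∧
    LocallyIntegrable (fun x => (w x)⁻¹) volume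

/-- The `L¹`-normalized indicator `h¹_E = 1_E / |E|`. -/
def h1 {d : ℕ} (E : Set (Fin d → ℝ)) : (Fin d → ℝ) → ℝ :=
  fun x => ((volume E).toReal)⁻¹ * E.indicator (fun _ => (1 : ℝ)) x

/-- Wilson's system of pairs of sets `(E¹_{α,I}, E²_{α,I})` indexed by dyadic cubes
`I` and `α ∈ Γ_d`. -/
structure WilsonSystem (d : ℕ) where
  E1 : DyadicCube d → Gamma d → Set (Fin d → ℝ)
  E2 : DyadicCube d → Gamma d → Set (Fin d → ℝ)
  childUnion1 : ∀ I α, ∃ S : Finset (DyadicCube d), S.Nonempty ∧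
    (∀ J ∈ S, J.IsChild I) ∧ E1 I α = ⋃ J ∈ S, J.toSet
  childUnion2 : ∀ I α, ∃ S : Finset (DyadicCube d), S.Nonempty ∧
    (∀ J ∈ S, J.IsChild I) ∧ E2 I α = ⋃ J ∈ S, J.toSet
  measEq : ∀ I α, volume (E1 I α) = volume (E2 I α)
  disj : ∀ I α, Disjoint (E1 I α) (E2 I α)
  nestedOrDisjoint : ∀ I α J β, (I, α) ≠ (J, β) →
    (E1 I α ∪ E2 I α) ⊆ E1 J β ∨ (E1 I α ∪ E2 I α) ⊆ E2 J β ∨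
    (E1 J β ∪ E2 J β) ⊆ E1 I α ∨ (E1 J β ∪ E2 J β) ⊆ E2 I α ∨
    Disjoint (E1 I α ∪ E2 I α) (E1 J β ∪ E2 J β)

namespace WilsonSystem

variable {d : ℕ}

/-- `E_{α,I} = E¹_{α,I} ∪ E²_{α,I}`. -/
def E (W : WilsonSystem d) (I : DyadicCube d) (α : Gamma d) : Set (Fin d → ℝ) :=
  W.E1 I α ∪ W.E2 I α

/-- The Wilson Haar function `h_I^α = |E_{α,I}|^{-1/2} (1_{E²_{α,I}} - 1_{E¹_{α,I}})`. -/
def haar (W : WilsonSystem d) (I : DyadicCube d) (α : Gamma d) : (Fin d → ℝ) → ℝ :=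
  fun x => (Real.sqrt (volume (W.E I α)).toReal)⁻¹ *
    ((W.E2 I α).indicator (fun _ => (1 : ℝ)) x - (W.E1 I α).indicator (fun _ => (1 : ℝ)) x)

/-- The Haar coefficient `f̂(I,α) = ⟨f, h_I^α⟩_{L²}`. -/
def hcoef (W : WilsonSystem d) (f : (Fin d → ℝ) → ℝ) (I : DyadicCube d) (α : Gamma d) : ℝ :=
  ∫ x, f x * W.haar I α x

/-- The weighted Wilson Haar function `h_I^{w,α}`. -/
def haarW (W : WilsonSystem d) (w : (Fin d → ℝ) → ℝ) (I : DyadicCube d) (α : Gamma d) :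
    (Fin d → ℝ) → ℝ :=
  fun x => (Real.sqrt (∫ y in W.E I α, w y))⁻¹ *
    (Real.sqrt ((∫ y in W.E1 I α, w y) / (∫ y in W.E2 I α, w y)) *
        (W.E2 I α).indicator (fun _ => (1 : ℝ)) x -
      Real.sqrt ((∫ y in W.E2 I α, w y) / (∫ y in W.E1 I α, w y)) *
        (W.E1 I α).indicator (fun _ => (1 : ℝ)) x)

/-- The Haar multiplier `T_σ f = ∑_{I,α} σ_{I,α} f̂(I,α) h_I^α`. -/
def Tmult (W : WilsonSystem d) (σ : DyadicCube d → Gamma d → ℝ) (f : (Fin d → ℝ) → ℝ) :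
    (Fin d → ℝ) → ℝ :=
  fun x => ∑' p : DyadicCube d × Gamma d, σ p.1 p.2 * W.hcoef f p.1 p.2 * W.haar p.1 p.2 x

/-- The paraproduct `P_a^{(0,0)} f = ∑_{I,α} a_{I,α} f̂(I,α) h_I^α`. -/
def P00 (W : WilsonSystem d) (a : DyadicCube d → Gamma d → ℝ) (f : (Fin d → ℝ) → ℝ) :
    (Fin d → ℝ) → ℝ :=
  fun x => ∑' p : DyadicCube d × Gamma d, a p.1 p.2 * W.hcoef f p.1 p.2 * W.haar p.1 p.2 x

/-- The paraproduct `P_a^{(0,1)} f = ∑_{I,α} a_{I,α} ⟨f⟩_{E_{α,I}} h_I^α`. -/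
def P01 (W : WilsonSystem d) (a : DyadicCube d → Gamma d → ℝ) (f : (Fin d → ℝ) → ℝ) :
    (Fin d → ℝ) → ℝ :=
  fun x => ∑' p : DyadicCube d × Gamma d, a p.1 p.2 * avg (W.E p.1 p.2) f * W.haar p.1 p.2 x

/-- The paraproduct `P_a^{(1,0)} f = ∑_{I,α} a_{I,α} f̂(I,α) h¹_{E_{α,I}}`. -/
def P10 (W : WilsonSystem d) (a : DyadicCube d → Gamma d → ℝ) (f : (Fin d → ℝ) → ℝ) :
    (Fin d → ℝ) → ℝ :=
  fun x => ∑' p : DyadicCube d × Gamma d, a p.1 p.2 * W.hcoef f p.1 p.2 * h1 (W.E p.1 p.2) x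

/-- The dyadic square function
`S f(x) = (∑_{I,α} |f̂(I,α)|² 1_I(x)/|I|)^{1/2}`. -/
def sqFn (W : WilsonSystem d) (f : (Fin d → ℝ) → ℝ) : (Fin d → ℝ) → ℝ :=
  fun x => Real.sqrt (∑' p : DyadicCube d × Gamma d,
    (W.hcoef f p.1 p.2) ^ 2 * p.1.toSet.indicator (fun _ => (1 : ℝ)) x /
      (volume p.1.toSet).toReal)

/-- The canonical paraproduct of type `ε` built from the function `g`:
`ε = 0` gives `P^{(0,1)}_{ĝ}`, `ε = 1` gives `P^{(1,0)}_{ĝ}`, and `ε = 2` gives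
`P^{(0,0)}_{⟨g⟩}`. -/
def paraOf (W : WilsonSystem d) (g : (Fin d → ℝ) → ℝ) (ε : Fin 3) :
    ((Fin d → ℝ) → ℝ) → ((Fin d → ℝ) → ℝ) :=
  if ε = 0 then W.P01 (fun I α => W.hcoef g I α)
  else if ε = 1 then W.P10 (fun I α => W.hcoef g I α)
  else W.P00 (fun I α => avg (W.E I α) g)

end WilsonSystem

/-- The weighted measure `w(x) dx` on `ℝ^d`. -/
def wMeasure {d : ℕ} (w : (Fin d → ℝ) → ℝ) : Measure (Fin d → ℝ) :=
  volume.withDensity fun x => ENNReal.ofReal (w x)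

/-! ### Helper material -/

namespace CarlesonAux

variable {d : ℕ}

/-- The child of `I` indexed by `ε`. -/
def child (I : DyadicCube d) (ε : Fin d → Bool) : DyadicCube d :=
  ⟨I.k - 1, fun i => 2 * I.m i + (if ε i then 1 else 0)⟩

/-- The lower corner. -/
def corner (I : DyadicCube d) : Fin d → ℝ := fun i => (I.m i : ℝ) * (2 : ℝ) ^ I.k

lemma two_zpow_pos (k : ℤ) : (0 : ℝ) < (2 : ℝ) ^ k := by positivity

lemma corner_mem (I : DyadicCube d) : corner I ∈ I.toSet := by
  intro i
  have := two_zpow_pos I.k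
  simp only [corner]
  constructor <;> nlinarith

lemma zpow_half (k : ℤ) : (2 : ℝ) ^ k = 2 * (2 : ℝ) ^ (k - 1) := by
  rw [zpow_sub_one₀ (by norm_num)]; ring

lemma toSet_eq_pi (I : DyadicCube d) :
    I.toSet = Set.pi Set.univ
      (fun i => Set.Ico ((I.m i : ℝ) * (2 : ℝ) ^ I.k) (((I.m i : ℝ) + 1) * (2 : ℝ) ^ I.k)) := by
  ext x; simp [DyadicCube.toSet, Set.mem_pi]

lemma toSet_eq_cube (I : DyadicCube d) : I.toSet = Cube (corner I) ((2 : ℝ) ^ I.k) := by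
  ext x; simp [DyadicCube.toSet, Cube, corner, add_mul]

lemma meas_toSet (I : DyadicCube d) : MeasurableSet I.toSet := by
  rw [toSet_eq_pi]
  exact MeasurableSet.univ_pi (fun i => measurableSet_Ico)

lemma vol_toSet (I : DyadicCube d) : volume I.toSet = ENNReal.ofReal (((2 : ℝ) ^ I.k) ^ d) := by
  rw [toSet_eq_pi, volume_pi_pi]
  have := two_zpow_pos I.k
  simp only [Real.volume_Ico]
  have h : ∀ i : Fin d, ((I.m i : ℝ) + 1) * (2 : ℝ) ^ I.k - (I.m i : ℝ) * (2 : ℝ) ^ I.k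
      = (2 : ℝ) ^ I.k := fun i => by ring
  simp only [h, Finset.prod_const, Finset.card_univ, Fintype.card_fin]
  rw [ENNReal.ofReal_pow this.le]

/-- The volume as a real. -/
def vol (I : DyadicCube d) : ℝ := ((2 : ℝ) ^ I.k) ^ d

lemma vol_pos (I : DyadicCube d) : 0 < vol I := by unfold vol; positivity

lemma volr (I : DyadicCube d) : (volume I.toSet).toReal = vol I := by
  rw [vol_toSet]; exact ENNReal.toReal_ofReal (vol_pos I).le

lemma vol_ne_top (I : DyadicCube d) : volume I.toSet ≠ ⊤ := by
  rw [vol_toSet]; exact ENNReal.ofReal_ne_top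

lemma vol_child (I : DyadicCube d) (ε) : vol I = 2 ^ d * vol (child I ε) := by
  unfold vol child
  rw [zpow_half I.k, mul_pow]

lemma mem_child_of_mem {I : DyadicCube d} {x : Fin d → ℝ} (hx : x ∈ I.toSet) :
    ∃ ε, x ∈ (child I ε).toSet := by
  classical
  refine ⟨fun i => decide ((2 * (I.m i : ℝ) + 1) * (2 : ℝ) ^ (I.k - 1) ≤ x i), fun i => ?_⟩
  have h := hx i
  have h2 := zpow_half I.k
  have := two_zpow_pos (I.k - 1)
  rw [h2] at h
  simp only [child]
  by_cases hc : (2 * (I.m i : ℝ) + 1) * (2 : ℝ) ^ (I.k - 1) ≤ x i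
  · simp only [hc, decide_true, if_true]; push_cast
    constructor <;> nlinarith
  · simp only [hc, decide_false]; push_cast
    push Not at hc
    constructor
    · simp; nlinarith
    · simp; nlinarith

lemma child_subset (I : DyadicCube d) (ε) : (child I ε).toSet ⊆ I.toSet := by
  intro x hx i
  have h := hx i
  have h2 := zpow_half I.k
  have := two_zpow_pos (I.k - 1)
  simp only [child] at h
  push_cast at h
  rw [h2]
  split_ifs at h <;> constructor <;> nlinarith

lemma m_unique {a b : ℤ} {t x : ℝ} (ht : 0 < t) (h1 : (a : ℝ) * t ≤ x ∧ x < ((a : ℝ) + 1) * t)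
    (h2 : (b : ℝ) * t ≤ x ∧ x < ((b : ℝ) + 1) * t) : a = b := by
  have h3 : (a : ℝ) < b + 1 := by
    have : (a : ℝ) * t < ((b : ℝ) + 1) * t := by linarith
    exact lt_of_mul_lt_mul_right this ht.le
  have h4 : (b : ℝ) < a + 1 := by
    have : (b : ℝ) * t < ((a : ℝ) + 1) * t := by linarith
    exact lt_of_mul_lt_mul_right this ht.le
  have h5 : a < b + 1 := by exact_mod_cast h3
  have h6 : b < a + 1 := by exact_mod_cast h4
  omega

lemma eq_of_mem {I J : DyadicCube d} (hk : I.k = J.k) {x} (h1 : x ∈ I.toSet) (h2 : x ∈ J.toSet) :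
    I = J := by
  obtain ⟨k, m⟩ := I
  obtain ⟨k', m'⟩ := J
  simp only at hk
  subst hk
  congr 1
  funext i
  exact m_unique (two_zpow_pos k) (h1 i) (h2 i)

lemma child_inj (I : DyadicCube d) : Function.Injective (child I) := by
  intro ε ε' h
  funext i
  have := congrFun (congrArg DyadicCube.m h) i
  simp only [child] at this
  cases h1 : ε i <;> cases h2 : ε' i <;> simp [h1, h2] at this ⊢

lemma child_disj (I : DyadicCube d) {ε ε'} (h : ε ≠ ε') :
    Disjoint (child I ε).toSet (child I ε').toSet := by
  rw [Set.disjoint_left]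
  intro x h1 h2
  exact h (child_inj I (eq_of_mem rfl h1 h2))

lemma isChild_eq {K I : DyadicCube d} (h : K.IsChild I) : ∃ ε, K = child I ε := by
  obtain ⟨ε, hε⟩ := mem_child_of_mem (h.2 (corner_mem K))
  exact ⟨ε, eq_of_mem (by have := h.1; simp only [child]; omega) (corner_mem K) hε⟩

lemma toSet_eq_iUnion (I : DyadicCube d) : I.toSet = ⋃ ε ∈ (Finset.univ : Finset (Fin d → Bool)),
    (child I ε).toSet := by
  ext x
  simp only [Finset.mem_univ, Set.iUnion_true, Set.mem_iUnion]
  exact ⟨mem_child_of_mem, fun ⟨ε, h⟩ => child_subset I ε h⟩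

/-- `J` is a descendant of `I` by at most `n` generations. -/
def Anc : ℕ → DyadicCube d → DyadicCube d → Prop
  | 0, J, I => J = I
  | n + 1, J, I => J = I ∨ ∃ ε, Anc n J (child I ε)

lemma anc_of_corner (J : DyadicCube d) : ∀ (n : ℕ) (I : DyadicCube d), J.k + n = I.k →
    corner J ∈ I.toSet → Anc n J I
  | 0, I, hk, h => eq_of_mem (by simpa using hk) (corner_mem J) h
  | n + 1, I, hk, h => by
    obtain ⟨ε, hε⟩ := mem_child_of_mem h
    exact Or.inr ⟨ε, anc_of_corner J n _ (by simp only [child]; push_cast at hk; omega) hε⟩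

lemma anc_succ (J : DyadicCube d) : ∀ (n : ℕ) (I : DyadicCube d), Anc n J I → Anc (n + 1) J I
  | 0, I, h => Or.inl h
  | n + 1, I, h => by
    rcases h with h | ⟨ε, h⟩
    · exact Or.inl h
    · exact Or.inr ⟨ε, anc_succ J n _ h⟩

lemma anc_mono {J I : DyadicCube d} {n m : ℕ} (h : n ≤ m) (ha : Anc n J I) : Anc m J I := by
  induction h with
  | refl => exact ha
  | step _ ih => exact anc_succ _ _ _ ih

lemma exists_anc (hd : d ≠ 0) {J I : DyadicCube d} (h : J.toSet ⊆ I.toSet) : ∃ n, Anc n J I := by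
  have hk : J.k ≤ I.k := by
    have h1 : vol J ≤ vol I := by
      rw [← volr, ← volr]
      exact ENNReal.toReal_mono (vol_ne_top I) (measure_mono h)
    unfold vol at h1
    have h2 := le_of_pow_le_pow_left₀ hd (two_zpow_pos I.k).le h1
    exact (zpow_le_zpow_iff_right₀ (by norm_num : (1 : ℝ) < 2)).1 h2
  exact ⟨(I.k - J.k).toNat, anc_of_corner J _ I (by omega) (h (corner_mem J))⟩

/-- Abstract telescoping induction. -/
lemma telescoping {ι : Type*} [DecidableEq ι] (t : DyadicCube d × ι → ℝ) (Φ : DyadicCube d → ℝ)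
    (ht : ∀ p, 0 ≤ t p) (hΦ : ∀ I, 0 ≤ Φ I) (T : DyadicCube d → ℝ) (hT : ∀ I, 0 ≤ T I)
    (htT : ∀ I (F : Finset (DyadicCube d × ι)), (∀ p ∈ F, p.1 = I) → ∑ p ∈ F, t p ≤ T I)
    (hstep : ∀ I, T I + ∑ ε, Φ (child I ε) ≤ Φ I) :
    ∀ (n : ℕ) (I : DyadicCube d) (F : Finset (DyadicCube d × ι)), (∀ p ∈ F, Anc n p.1 I) →
      ∑ p ∈ F, t p ≤ Φ I
  | 0, I, F, h => by
    have h1 := htT I F h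
    have h2 := hstep I
    have h3 : 0 ≤ ∑ ε, Φ (child I ε) := Finset.sum_nonneg (fun ε _ => hΦ _)
    linarith
  | n + 1, I, F, h => by
    classical
    have h2 := hstep I
    have h1 := htT I (F.filter (fun p => p.1 = I)) (fun p hp => (Finset.mem_filter.1 hp).2)
    have h3 : ∑ p ∈ F with ¬ p.1 = I, t p ≤
        ∑ ε, ∑ p ∈ F with Anc n p.1 (child I ε), t p := by
      rw [← Finset.sum_fiberwise_of_maps_to (s := F.filter (fun p => ¬ p.1 = I))
        (t := (Finset.univ : Finset (Fin d → Bool)))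
        (g := fun p => if hp : ∃ ε, Anc n p.1 (child I ε) then hp.choose else fun _ => true)
        (fun _ _ => Finset.mem_univ _)]
      refine Finset.sum_le_sum (fun ε _ => ?_)
      refine Finset.sum_le_sum_of_subset_of_nonneg ?_ (fun p _ _ => ht p)
      intro p hp
      simp only [Finset.mem_filter] at hp ⊢
      refine ⟨hp.1.1, ?_⟩
      have hex : ∃ ε, Anc n p.1 (child I ε) := (h p hp.1.1).resolve_left hp.1.2
      have := hp.2
      rw [dif_pos hex] at this
      rw [← this]; exact hex.choose_spec
    have h4 : ∑ ε, ∑ p ∈ F with Anc n p.1 (child I ε), t p ≤ ∑ ε, Φ (child I ε) :=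
      Finset.sum_le_sum (fun ε _ => telescoping t Φ ht hΦ T hT htT hstep n _ _
        (fun p hp => (Finset.mem_filter.1 hp).2))
    rw [← Finset.sum_filter_add_sum_filter_not F (fun p => p.1 = I)]
    linarith

lemma log_ineq {t M : ℝ} (ht : 0 < t) (hM : t ≤ M) :
    Real.log t + (t - 1) ^ 2 / (2 * (M + 1)) ≤ t - 1 := by
  obtain ⟨s, hs, rfl⟩ : ∃ s : ℝ, 0 < s ∧ t = s ^ 2 :=
    ⟨Real.sqrt t, Real.sqrt_pos.2 ht, (Real.sq_sqrt ht.le).symm⟩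
  have h1 := Real.log_le_sub_one_of_pos hs
  rw [Real.log_pow]
  have h2 : (s ^ 2 - 1) ^ 2 / (2 * (M + 1)) ≤ (s - 1) ^ 2 := by
    rw [div_le_iff₀ (by linarith)]
    have : (s ^ 2 - 1) ^ 2 = (s - 1) ^ 2 * (s + 1) ^ 2 := by ring
    rw [this]
    apply mul_le_mul_of_nonneg_left _ (sq_nonneg _)
    nlinarith [sq_nonneg (s - 1)]
  push_cast
  nlinarith

/-- The averages in terms of `vol`. -/
lemma avg_eq (I : DyadicCube d) (f : (Fin d → ℝ) → ℝ) :
    avg I.toSet f = (∫ x in I.toSet, f x) / vol I := by rw [avg, volr]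

lemma intOn {f : (Fin d → ℝ) → ℝ} (hf : LocallyIntegrable f volume) (I : DyadicCube d) :
    IntegrableOn f I.toSet := by
  have h : IsCompact (Set.pi Set.univ
      (fun i => Set.Icc ((I.m i : ℝ) * (2 : ℝ) ^ I.k) (((I.m i : ℝ) + 1) * (2 : ℝ) ^ I.k))) :=
    isCompact_univ_pi (fun i => isCompact_Icc)
  refine (hf.integrableOn_isCompact h).mono_set ?_
  rw [toSet_eq_pi]
  exact Set.pi_mono (fun i _ => Set.Ico_subset_Icc_self)

lemma const_intOn (I : DyadicCube d) (c : ℝ) : IntegrableOn (fun _ => c) I.toSet := 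
  integrableOn_const (vol_ne_top I)

lemma int_const (I : DyadicCube d) (c : ℝ) : ∫ _ in I.toSet, c = vol I * c := by
  rw [setIntegral_const, measureReal_def, volr, smul_eq_mul]

/-- Decomposition over the children. -/
lemma int_children {f : (Fin d → ℝ) → ℝ} (I : DyadicCube d) (hf : IntegrableOn f I.toSet) :
    ∫ x in I.toSet, f x = ∑ ε, ∫ x in (child I ε).toSet, f x := by
  conv_lhs => rw [toSet_eq_iUnion]
  rw [integral_biUnion_finset]
  · exact fun ε _ => meas_toSet _
  · exact fun ε _ ε' _ h => child_disj I h
  · exact fun ε _ => hf.mono_set (child_subset I ε)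

lemma avg_children {f : (Fin d → ℝ) → ℝ} (I : DyadicCube d) (hf : IntegrableOn f I.toSet) :
    ∑ ε, avg (child I ε).toSet f = 2 ^ d * avg I.toSet f := by
  rw [avg_eq, int_children I hf, Finset.sum_div, Finset.mul_sum]
  refine Finset.sum_congr rfl (fun ε _ => ?_)
  rw [avg_eq, vol_child I ε]
  have := vol_pos (child I ε)
  field_simp

lemma avg_pos {f : (Fin d → ℝ) → ℝ} (I : DyadicCube d) (hf : IntegrableOn f I.toSet)
    (hp : ∀ x, 0 < f x) : 0 < avg I.toSet f := by
  rw [avg_eq]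
  refine div_pos ?_ (vol_pos I)
  rw [setIntegral_pos_iff_support_of_nonneg_ae
    (Filter.Eventually.of_forall (fun x => (hp x).le)) hf]
  have : Function.support f = Set.univ := by
    ext x; simp [(hp x).ne']
  rw [this, Set.univ_inter, vol_toSet, ENNReal.ofReal_pos]
  exact vol_pos I

lemma avg_mono {f g : (Fin d → ℝ) → ℝ} (I : DyadicCube d) (hf : IntegrableOn f I.toSet)
    (hg : IntegrableOn g I.toSet) (h : ∀ x, f x ≤ g x) : avg I.toSet f ≤ avg I.toSet g := by
  rw [avg_eq, avg_eq]
  exact div_le_div_of_nonneg_right (integral_mono hf hg h) (vol_pos I).le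

lemma intOn_comb {f g : (Fin d → ℝ) → ℝ} (I : DyadicCube d) (hf : IntegrableOn f I.toSet)
    (hg : IntegrableOn g I.toSet) (a b c : ℝ) :
    IntegrableOn (fun x => a * f x + b * g x + c) I.toSet :=
  ((hf.const_mul a).add (hg.const_mul b)).add (const_intOn I c)

lemma avg_add_const {f g : (Fin d → ℝ) → ℝ} (I : DyadicCube d) (hf : IntegrableOn f I.toSet)
    (hg : IntegrableOn g I.toSet) (a b c : ℝ) :
    avg I.toSet (fun x => a * f x + b * g x + c) = a * avg I.toSet f + b * avg I.toSet g + c := by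
  simp only [avg_eq]
  have hab : IntegrableOn (fun x => a * f x + b * g x) I.toSet :=
    (hf.const_mul a).add (hg.const_mul b)
  rw [integral_add hab (const_intOn I c),
    integral_add (hf.const_mul a) (hg.const_mul b), integral_const_mul, integral_const_mul,
    int_const]
  have := (vol_pos I).ne'
  field_simp

/-- `⟨f⟩ ⟨1/f⟩ ≥ 1`. -/
lemma one_le_avg_mul {f g : (Fin d → ℝ) → ℝ} (I : DyadicCube d) (hf : IntegrableOn f I.toSet)
    (hg : IntegrableOn g I.toSet) (hp : ∀ x, 0 < f x) (hfg : ∀ x, f x * g x = 1) :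
    1 ≤ avg I.toSet f * avg I.toSet g := by
  have ha := avg_pos I hf hp
  set a := avg I.toSet f with ha_def
  have h0 : avg I.toSet (fun _ => (0 : ℝ)) = 0 := by simp [avg]
  have h := avg_mono (f := fun _ => 0) (g := fun x => a⁻¹ * f x + a * g x + (-2)) I
    (const_intOn I 0)
    (intOn_comb I hf hg _ _ _) (fun x => by
      have h1 := hp x
      have h2 : g x = (f x)⁻¹ := by
        have := hfg x; field_simp; linarith
      rw [h2]
      have : a⁻¹ * f x + a * (f x)⁻¹ + -2 = (a - f x) ^ 2 * (a⁻¹ * (f x)⁻¹) := by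
        field_simp; ring
      rw [this]; positivity)
  rw [h0, avg_add_const I hf hg, ← ha_def, inv_mul_cancel₀ ha.ne'] at h
  linarith

/-- `⟨f⟩² ≤ ⟨f²⟩`. -/
lemma avg_sq_le {f g : (Fin d → ℝ) → ℝ} (I : DyadicCube d) (hf : IntegrableOn f I.toSet)
    (hg : IntegrableOn g I.toSet) (hfg : ∀ x, g x = f x ^ 2) :
    avg I.toSet f ^ 2 ≤ avg I.toSet g := by
  set a := avg I.toSet f with ha_def
  have h0 : avg I.toSet (fun _ => (0 : ℝ)) = 0 := by simp [avg]
  have h := avg_mono (f := fun _ => 0) (g := fun x => (-2 * a) * f x + 1 * g x + a ^ 2) I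
    (const_intOn I 0)
    (intOn_comb I hf hg _ _ _) (fun x => by
      rw [hfg]; nlinarith [sq_nonneg (f x - a)])
  rw [h0, avg_add_const I hf hg, ← ha_def] at h
  nlinarith

lemma avg_child_le {f : (Fin d → ℝ) → ℝ} (I : DyadicCube d) (hf : IntegrableOn f I.toSet)
    (hp : ∀ x, 0 < f x) (ε) : avg (child I ε).toSet f ≤ 2 ^ d * avg I.toSet f := by
  rw [← avg_children I hf]
  exact Finset.single_le_sum (f := fun ε => avg (child I ε).toSet f)
    (fun ε _ => (avg_pos _ (hf.mono_set (child_subset I ε)) hp).le) (Finset.mem_univ ε)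

lemma card_eps : (Finset.univ : Finset (Fin d → Bool)).card = 2 ^ d := by simp

/-- One step of the Bellman induction for the logarithm. -/
lemma log_step {f : (Fin d → ℝ) → ℝ} (I : DyadicCube d) (hf : IntegrableOn f I.toSet)
    (hp : ∀ x, 0 < f x) :
    (∑ ε, (avg (child I ε).toSet f / avg I.toSet f - 1) ^ 2) / (2 * (2 ^ d + 1)) +
      ∑ ε, Real.log (avg (child I ε).toSet f) ≤ 2 ^ d * Real.log (avg I.toSet f) := by
  have ha := avg_pos I hf hp
  have hsum := avg_children I hf
  have key : ∀ ε, (avg (child I ε).toSet f / avg I.toSet f - 1) ^ 2 / (2 * (2 ^ d + 1)) +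
      Real.log (avg (child I ε).toSet f) ≤
      Real.log (avg I.toSet f) + (avg (child I ε).toSet f / avg I.toSet f - 1) := by
    intro ε
    have hb := avg_pos _ (hf.mono_set (child_subset I ε)) hp
    have hle := avg_child_le I hf hp ε
    have := log_ineq (t := avg (child I ε).toSet f / avg I.toSet f) (M := 2 ^ d)
      (by positivity) (by rw [div_le_iff₀ ha]; exact hle)
    rw [Real.log_div hb.ne' ha.ne'] at this
    linarith
  have := Finset.sum_le_sum (s := Finset.univ) (fun ε _ => key ε)
  rw [Finset.sum_add_distrib, Finset.sum_add_distrib, Finset.sum_sub_distrib, ← Finset.sum_div,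
    ← Finset.sum_div, hsum] at this
  simp only [Finset.sum_const, card_eps, nsmul_eq_mul] at this
  push_cast at this
  rw [mul_div_assoc, div_self ha.ne'] at this
  linarith

/-- Structure of the sets in a Wilson system: bound of integrals. -/
lemma union_children {I : DyadicCube d} {X : Set (Fin d → ℝ)}
    (h : ∃ S : Finset (DyadicCube d), S.Nonempty ∧
      (∀ J ∈ S, J.IsChild I) ∧ X = ⋃ J ∈ S, J.toSet) :
    ∃ S : Finset (Fin d → Bool), S.Nonempty ∧ X = ⋃ ε ∈ S, (child I ε).toSet := by
  classical
  obtain ⟨S, hS, hc, rfl⟩ := h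
  refine ⟨Finset.univ.filter (fun ε => child I ε ∈ S), ?_, ?_⟩
  · obtain ⟨J, hJ⟩ := hS
    obtain ⟨ε, rfl⟩ := isChild_eq (hc J hJ)
    exact ⟨ε, by simpa using hJ⟩
  · ext x
    simp only [Set.mem_iUnion, Finset.mem_filter, Finset.mem_univ, true_and]
    constructor
    · rintro ⟨J, hJ, hx⟩
      obtain ⟨ε, rfl⟩ := isChild_eq (hc J hJ)
      exact ⟨ε, hJ, hx⟩
    · rintro ⟨ε, hJ, hx⟩
      exact ⟨_, hJ, hx⟩

/-- Everything needed about a union of children. -/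
lemma union_facts {I : DyadicCube d} {X : Set (Fin d → ℝ)}
    (h : ∃ S : Finset (DyadicCube d), S.Nonempty ∧
      (∀ J ∈ S, J.IsChild I) ∧ X = ⋃ J ∈ S, J.toSet) :
    MeasurableSet X ∧ X ⊆ I.toSet ∧ vol I ≤ 2 ^ d * (volume X).toReal ∧
    ∀ f : (Fin d → ℝ) → ℝ, IntegrableOn f I.toSet →
      |(∫ x in X, f x) - avg I.toSet f * (volume X).toReal| ≤
        (2 ^ d)⁻¹ * vol I * ∑ ε, |avg (child I ε).toSet f - avg I.toSet f| := by
  obtain ⟨S, ⟨ε₀, hε₀⟩, rfl⟩ := union_children h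
  have hm : MeasurableSet (⋃ ε ∈ S, (child I ε).toSet) :=
    Finset.measurableSet_biUnion _ (fun ε _ => meas_toSet _)
  have hs : (⋃ ε ∈ S, (child I ε).toSet) ⊆ I.toSet :=
    Set.iUnion₂_subset (fun ε _ => child_subset I ε)
  refine ⟨hm, hs, ?_, ?_⟩
  · rw [vol_child I ε₀, ← volr]
    refine mul_le_mul_of_nonneg_left ?_ (by positivity)
    refine ENNReal.toReal_mono ?_ (measure_mono ?_)
    · exact ((measure_mono hs).trans_lt (vol_ne_top I).lt_top).ne
    · exact Set.subset_biUnion_of_mem (u := fun ε => (child I ε).toSet) hε₀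
  · intro f hf
    set a := avg I.toSet f
    have hφ : IntegrableOn (fun x => f x - a) I.toSet := hf.sub (const_intOn I a)
    have e1 : (∫ x in (⋃ ε ∈ S, (child I ε).toSet), f x) -
        a * (volume (⋃ ε ∈ S, (child I ε).toSet)).toReal =
        ∫ x in (⋃ ε ∈ S, (child I ε).toSet), (f x - a) := by
      rw [integral_sub (hf.mono_set hs) ((const_intOn I a).mono_set hs), setIntegral_const,
        measureReal_def, smul_eq_mul, mul_comm]
    rw [e1, integral_biUnion_finset S (fun ε _ => meas_toSet _)
      (fun ε _ ε' _ h => child_disj I h) (fun ε _ => hφ.mono_set (child_subset I ε))]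
    refine (Finset.abs_sum_le_sum_abs _ _).trans ?_
    refine (Finset.sum_le_sum_of_subset_of_nonneg (Finset.subset_univ S)
      (fun _ _ _ => abs_nonneg _)).trans ?_
    rw [Finset.mul_sum]
    refine Finset.sum_le_sum (fun ε _ => le_of_eq ?_)
    have hv := vol_pos (child I ε)
    have hv2 : (2 ^ d)⁻¹ * vol I = vol (child I ε) := by
      rw [vol_child I ε]; field_simp
    rw [hv2, integral_sub (hf.mono_set (child_subset I ε)) (const_intOn _ a), int_const,
      avg_eq (child I ε)]
    rw [← abs_of_pos hv, ← abs_mul, abs_of_pos hv]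
    congr 1
    field_simp

lemma hcoef_eq (W : WilsonSystem d) (I : DyadicCube d) (α : Gamma d) {f : (Fin d → ℝ) → ℝ}
    (hf : IntegrableOn f I.toSet) :
    W.hcoef f I α = (Real.sqrt (volume (W.E I α)).toReal)⁻¹ *
      ((∫ x in W.E2 I α, f x) - ∫ x in W.E1 I α, f x) := by
  obtain ⟨m1, s1, -, -⟩ := union_facts (W.childUnion1 I α)
  obtain ⟨m2, s2, -, -⟩ := union_facts (W.childUnion2 I α)
  unfold WilsonSystem.hcoef WilsonSystem.haar
  rw [← integral_indicator m1, ← integral_indicator m2, ← integral_sub, ← integral_const_mul]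
  · congr 1
    funext x
    by_cases h1 : x ∈ W.E1 I α <;> by_cases h2 : x ∈ W.E2 I α <;> simp [h1, h2] <;> ring
  · exact (hf.mono_set s2).integrable_indicator m2
  · exact (hf.mono_set s1).integrable_indicator m1

lemma volE_ge (W : WilsonSystem d) (I : DyadicCube d) (α : Gamma d) :
    vol I ≤ 2 ^ d * (volume (W.E I α)).toReal := by
  obtain ⟨m1, s1, v1, -⟩ := union_facts (W.childUnion1 I α)
  obtain ⟨m2, s2, -, -⟩ := union_facts (W.childUnion2 I α)
  refine v1.trans (mul_le_mul_of_nonneg_left ?_ (by positivity))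
  refine ENNReal.toReal_mono ?_ (measure_mono Set.subset_union_left)
  exact ((measure_mono (Set.union_subset s1 s2)).trans_lt (vol_ne_top I).lt_top).ne

lemma hcoef_sq_le (W : WilsonSystem d) (I : DyadicCube d) (α : Gamma d) {f : (Fin d → ℝ) → ℝ}
    (hf : IntegrableOn f I.toSet) :
    (W.hcoef f I α) ^ 2 ≤
      4 * vol I * ∑ ε, (avg (child I ε).toSet f - avg I.toSet f) ^ 2 := by
  obtain ⟨-, -, -, b1⟩ := union_facts (W.childUnion1 I α)
  obtain ⟨-, -, -, b2⟩ := union_facts (W.childUnion2 I α)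
  have hE := volE_ge W I α
  have hI := vol_pos I
  set V := (volume (W.E I α)).toReal with hV
  have hVpos : 0 < V := by
    by_contra hcon
    push Not at hcon
    have : (2 : ℝ) ^ d * V ≤ 0 := mul_nonpos_of_nonneg_of_nonpos (by positivity) hcon
    linarith
  have b1' := b1 f hf
  have b2' := b2 f hf
  rw [W.measEq I α] at b1'
  rw [hcoef_eq W I α hf, mul_pow, inv_pow, Real.sq_sqrt hVpos.le]
  set D := (∫ x in W.E2 I α, f x) - ∫ x in W.E1 I α, f x with hD
  set s := ∑ ε, |avg (child I ε).toSet f - avg I.toSet f| with hs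
  have hs0 : 0 ≤ s := Finset.sum_nonneg (fun _ _ => abs_nonneg _)
  have hDle : |D| ≤ 2 * ((2 ^ d)⁻¹ * vol I * s) := by
    rw [abs_le] at b1' b2' ⊢
    constructor <;> linarith [b1'.1, b1'.2, b2'.1, b2'.2]
  have hs2 : s ^ 2 ≤ 2 ^ d * ∑ ε, (avg (child I ε).toSet f - avg I.toSet f) ^ 2 := by
    have := sq_sum_le_card_mul_sum_sq (s := (Finset.univ : Finset (Fin d → Bool)))
      (f := fun ε => |avg (child I ε).toSet f - avg I.toSet f|)
    simp only [sq_abs, card_eps] at this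
    push_cast at this
    exact this
  set Q := ∑ ε, (avg (child I ε).toSet f - avg I.toSet f) ^ 2 with hQ
  have hD2 : D ^ 2 ≤ (2 * ((2 ^ d)⁻¹ * vol I * s)) ^ 2 := by
    rw [← sq_abs D]
    exact pow_le_pow_left₀ (abs_nonneg _) hDle 2
  have hQ0 : 0 ≤ Q := Finset.sum_nonneg (fun _ _ => sq_nonneg _)
  rw [inv_mul_le_iff₀ hVpos]
  have hN : (0 : ℝ) < 2 ^ d := by positivity
  set N : ℝ := 2 ^ d
  calc D ^ 2 ≤ (2 * (N⁻¹ * vol I * s)) ^ 2 := hD2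
    _ = 4 * N⁻¹ ^ 2 * vol I ^ 2 * s ^ 2 := by ring
    _ ≤ 4 * N⁻¹ ^ 2 * vol I ^ 2 * (N * Q) := by gcongr
    _ = 4 * N⁻¹ * vol I * Q * vol I := by field_simp
    _ ≤ 4 * N⁻¹ * vol I * Q * (N * V) := by gcongr
    _ = V * (4 * vol I * Q) := by field_simp

instance : Fintype (Gamma d) := by unfold Gamma; infer_instance

lemma card_gamma_le : (Fintype.card (Gamma d) : ℝ) ≤ 2 ^ d := by
  have : Fintype.card (Gamma d) ≤ Fintype.card (Fin d → Bool) :=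
    Fintype.card_le_of_injective (fun v : Gamma d => v.1) Subtype.val_injective
  have h2 : Fintype.card (Fin d → Bool) = 2 ^ d := by simp
  rw [h2] at this
  exact_mod_cast this

lemma locInt_sqrt {w : (Fin d → ℝ) → ℝ} (hpos : ∀ x, 0 < w x) (hm : Measurable w)
    (I : DyadicCube d) (h : IntegrableOn w I.toSet) :
    IntegrableOn (fun x => Real.sqrt (w x)) I.toSet := by
  refine Integrable.mono' ((const_intOn I 1).add h) hm.sqrt.aestronglyMeasurable ?_
  refine Filter.Eventually.of_forall (fun x => ?_)
  rw [Real.norm_of_nonneg (Real.sqrt_nonneg _)]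
  simp only [Pi.add_apply]
  have h1 := Real.sq_sqrt (hpos x).le
  nlinarith [sq_nonneg (Real.sqrt (w x) - 1), Real.sqrt_nonneg (w x)]

end CarlesonAux

/-- Square-function type Carleson estimate:
`∑_{J⊆I} ∑_{β : E_{β,J} ⊆ E_{α,I}} |ŵ^{-1/2}(J,β)|² ⟨w⟩_J ≤ C_d [w]²_{A₂} |E_{α,I}|`. -/
theorem carleson_estimate_whalfinv_avgw (d : ℕ) :
    ∃ C : ℝ, 0 < C ∧
      ∀ (W : WilsonSystem d) (w : (Fin d → ℝ) → ℝ) (A : ℝ),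
        IsWeight w → IsA2Bound w A →
        ∀ (I : DyadicCube d) (α : Gamma d) (F : Finset (DyadicCube d × Gamma d)),
          (∀ p ∈ F, p.1.toSet ⊆ I.toSet ∧ W.E p.1 p.2 ⊆ W.E I α) →
          ∑ p ∈ F,
              (W.hcoef (fun x => (Real.sqrt (w x))⁻¹) p.1 p.2) ^ 2 * avg p.1.toSet w ≤
            C * A ^ 2 * (volume (W.E I α)).toReal := by
  classical
  refine ⟨4 * 2 ^ d * 2 ^ d * (2 * (2 ^ d + 1)) * 2 ^ d, by positivity, ?_⟩
  intro W w A hw hA I α F hF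
  obtain ⟨hpos, hmeas, hloc, hloc'⟩ := hw
  have hd : d ≠ 0 := by
    rintro rfl
    exact α.2 (funext (fun i => i.elim0))
  set f : (Fin d → ℝ) → ℝ := fun x => (Real.sqrt (w x))⁻¹ with hfdef
  set g : (Fin d → ℝ) → ℝ := fun x => Real.sqrt (w x) with hgdef
  have hfpos : ∀ x, 0 < f x := fun x => inv_pos.2 (Real.sqrt_pos.2 (hpos x))
  have hgpos : ∀ x, 0 < g x := fun x => Real.sqrt_pos.2 (hpos x)
  have hfg : ∀ x, f x * g x = 1 := fun x => inv_mul_cancel₀ (hgpos x).ne'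
  have hwi : ∀ J : DyadicCube d, IntegrableOn w J.toSet := CarlesonAux.intOn hloc
  have hwi' : ∀ J : DyadicCube d, IntegrableOn (fun x => (w x)⁻¹) J.toSet :=
    CarlesonAux.intOn hloc'
  have hgi : ∀ J : DyadicCube d, IntegrableOn g J.toSet := fun J =>
    CarlesonAux.locInt_sqrt hpos hmeas J (hwi J)
  have hfi : ∀ J : DyadicCube d, IntegrableOn f J.toSet := fun J => by
    have := CarlesonAux.locInt_sqrt (fun x => inv_pos.2 (hpos x)) hmeas.inv J (hwi' J)
    simpa only [Real.sqrt_inv] using this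
  have hA2 : ∀ J : DyadicCube d, avg J.toSet w * avg J.toSet (fun x => (w x)⁻¹) ≤ A := fun J => by
    rw [CarlesonAux.toSet_eq_cube]
    exact hA _ _ (CarlesonAux.two_zpow_pos J.k)
  have hap : ∀ J : DyadicCube d, 0 < avg J.toSet f := fun J => CarlesonAux.avg_pos J (hfi J) hfpos
  have hbp : ∀ J : DyadicCube d, 0 < avg J.toSet g := fun J => CarlesonAux.avg_pos J (hgi J) hgpos
  have hwp : ∀ J : DyadicCube d, 0 < avg J.toSet w := fun J => CarlesonAux.avg_pos J (hwi J) hpos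
  have hf2 : ∀ J : DyadicCube d, avg J.toSet f ^ 2 ≤ avg J.toSet (fun x => (w x)⁻¹) := fun J =>
    CarlesonAux.avg_sq_le J (hfi J) (hwi' J) (fun x => by
      simp only [hfdef, inv_pow, Real.sq_sqrt (hpos x).le])
  have hg2 : ∀ J : DyadicCube d, avg J.toSet g ^ 2 ≤ avg J.toSet w := fun J =>
    CarlesonAux.avg_sq_le J (hgi J) (hwi J) (fun x => by
      simp only [hgdef, Real.sq_sqrt (hpos x).le])
  have h1 : ∀ J : DyadicCube d, 1 ≤ avg J.toSet f * avg J.toSet g := fun J =>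
    CarlesonAux.one_le_avg_mul J (hfi J) (hgi J) hfpos hfg
  have hwf : ∀ J : DyadicCube d, avg J.toSet w * avg J.toSet f ^ 2 ≤ A := fun J =>
    (mul_le_mul_of_nonneg_left (hf2 J) (hwp J).le).trans (hA2 J)
  have hfgA : ∀ J : DyadicCube d, (avg J.toSet f * avg J.toSet g) ^ 2 ≤ A := fun J => by
    refine le_trans ?_ (hwf J)
    rw [mul_pow, mul_comm]
    exact mul_le_mul_of_nonneg_right (hg2 J) (sq_nonneg _)
  have hA0 : 0 ≤ A := (sq_nonneg _).trans (hfgA I)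
  -- the Bellman function
  set B : DyadicCube d → ℝ := fun J => Real.log (avg J.toSet f) + Real.log (avg J.toSet g) with hB
  have hB0 : ∀ J, 0 ≤ B J := fun J => by
    simp only [hB]
    rw [← Real.log_mul (hap J).ne' (hbp J).ne']
    exact Real.log_nonneg (h1 J)
  have hBA : ∀ J, B J ≤ A := fun J => by
    simp only [hB]
    rw [← Real.log_mul (hap J).ne' (hbp J).ne']
    have e1 := Real.log_le_sub_one_of_pos (mul_pos (hap J) (hbp J))
    have e2 := hfgA J
    have e3 := h1 J
    nlinarith
  set N : ℝ := 2 ^ d with hN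
  have hNp : 0 < N := by positivity
  set Q : DyadicCube d → ℝ := fun J =>
    ∑ ε, (avg (CarlesonAux.child J ε).toSet f / avg J.toSet f - 1) ^ 2 with hQ
  have hQ0 : ∀ J, 0 ≤ Q J := fun J => Finset.sum_nonneg (fun _ _ => sq_nonneg _)
  have hstepB : ∀ J, Q J / (2 * (N + 1)) + ∑ ε, B (CarlesonAux.child J ε) ≤ N * B J := fun J => by
    have e1 := CarlesonAux.log_step J (hfi J) hfpos
    have e2 := CarlesonAux.log_step J (hgi J) hgpos
    have e3 : 0 ≤ (∑ ε, (avg (CarlesonAux.child J ε).toSet g / avg J.toSet g - 1) ^ 2) /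
        (2 * (2 ^ d + 1)) := div_nonneg (Finset.sum_nonneg (fun _ _ => sq_nonneg _)) (by positivity)
    simp only [hB, Finset.sum_add_distrib, hQ]
    linarith
  have hcoefb : ∀ (J : DyadicCube d) (β : Gamma d),
      (W.hcoef f J β) ^ 2 * avg J.toSet w ≤ 4 * CarlesonAux.vol J * A * Q J := fun J β => by
    have e1 := CarlesonAux.hcoef_sq_le W J β (hfi J)
    have e2 : ∑ ε, (avg (CarlesonAux.child J ε).toSet f - avg J.toSet f) ^ 2 =
        avg J.toSet f ^ 2 * Q J := by
      simp only [hQ, Finset.mul_sum]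
      refine Finset.sum_congr rfl (fun ε _ => ?_)
      have := (hap J).ne'
      rw [← mul_pow, mul_sub, mul_div_cancel₀ _ this, mul_one]
    rw [e2] at e1
    have hv := CarlesonAux.vol_pos J
    calc _ ≤ 4 * CarlesonAux.vol J * (avg J.toSet f ^ 2 * Q J) * avg J.toSet w :=
          mul_le_mul_of_nonneg_right e1 (hwp J).le
      _ = 4 * CarlesonAux.vol J * (avg J.toSet w * avg J.toSet f ^ 2) * Q J := by ring
      _ ≤ _ := by
          have := hwf J
          have := hQ0 J
          gcongr
  obtain ⟨n, hn⟩ : ∃ n, ∀ p ∈ F, CarlesonAux.Anc n p.1 I := by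
    have hex : ∀ p : DyadicCube d × Gamma d, ∃ n, p ∈ F → CarlesonAux.Anc n p.1 I := fun p => by
      by_cases hp : p ∈ F
      · obtain ⟨n, hn⟩ := CarlesonAux.exists_anc hd (hF p hp).1
        exact ⟨n, fun _ => hn⟩
      · exact ⟨0, fun h => absurd h hp⟩
    choose nn hnn using hex
    exact ⟨F.sup nn, fun p hp => CarlesonAux.anc_mono (Finset.le_sup hp) (hnn p hp)⟩
  have main := CarlesonAux.telescoping
    (t := fun p : DyadicCube d × Gamma d => (W.hcoef f p.1 p.2) ^ 2 * avg p.1.toSet w)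
    (Φ := fun J => 4 * N * N * (2 * (N + 1)) * A * CarlesonAux.vol J * B J)
    (fun p => mul_nonneg (sq_nonneg _) (hwp _).le)
    (fun J => by
      have := CarlesonAux.vol_pos J
      have := hB0 J
      positivity)
    (fun J => N * (4 * CarlesonAux.vol J * A * Q J))
    (fun J => by
      have := CarlesonAux.vol_pos J
      have := hQ0 J
      positivity)
    (fun J G hG => by
      have hb0 : 0 ≤ 4 * CarlesonAux.vol J * A * Q J := by
        have := CarlesonAux.vol_pos J
        have := hQ0 J
        positivity
      have e1 : ∑ p ∈ G, (W.hcoef f p.1 p.2) ^ 2 * avg p.1.toSet w ≤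
          G.card • (4 * CarlesonAux.vol J * A * Q J) :=
        Finset.sum_le_card_nsmul _ _ _ (fun p hp => by
          rw [hG p hp]; exact hcoefb J p.2)
      have e2 : G.card ≤ Fintype.card (Gamma d) := by
        rw [← Finset.card_univ]
        refine Finset.card_le_card_of_injOn (fun p => p.2) (fun _ _ => Finset.mem_univ _) ?_
        intro p hp q hq hpq
        exact Prod.ext ((hG p hp).trans (hG q hq).symm) hpq
      have e3 : (G.card : ℝ) ≤ N := le_trans (by exact_mod_cast e2) CarlesonAux.card_gamma_le
      rw [nsmul_eq_mul] at e1
      exact e1.trans (mul_le_mul_of_nonneg_right e3 hb0))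
    (fun J => by
      have e := hstepB J
      have hv := CarlesonAux.vol_pos J
      have e1 : ∑ ε, 4 * N * N * (2 * (N + 1)) * A * CarlesonAux.vol (CarlesonAux.child J ε) *
          B (CarlesonAux.child J ε) =
          4 * N * (2 * (N + 1)) * A * CarlesonAux.vol J * ∑ ε, B (CarlesonAux.child J ε) := by
        rw [Finset.mul_sum]
        refine Finset.sum_congr rfl (fun ε _ => ?_)
        rw [CarlesonAux.vol_child J ε]; ring
      rw [e1]
      have e4 := mul_le_mul_of_nonneg_left e
        (by positivity : 0 ≤ 4 * N * (2 * (N + 1)) * A * CarlesonAux.vol J)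
      have e5 : 4 * N * (2 * (N + 1)) * A * CarlesonAux.vol J * (Q J / (2 * (N + 1))) =
          N * (4 * CarlesonAux.vol J * A * Q J) := by
        field_simp
      rw [mul_add, e5] at e4
      refine e4.trans (le_of_eq ?_)
      ring)
    n I F hn
  refine main.trans ?_
  have hE := CarlesonAux.volE_ge W I α
  have hv := CarlesonAux.vol_pos I
  calc 4 * N * N * (2 * (N + 1)) * A * CarlesonAux.vol I * B I
      ≤ 4 * N * N * (2 * (N + 1)) * A * CarlesonAux.vol I * A := by
        gcongr
        exact hBA I
    _ = 4 * N * N * (2 * (N + 1)) * A * A * CarlesonAux.vol I := by ring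
    _ ≤ 4 * N * N * (2 * (N + 1)) * A * A * (N * (volume (W.E I α)).toReal) := by gcongr
    _ = _ := by ring
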